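/- arXiv:1112.2004 — 2 statements merged into one kernel-verified Lean document; each statement's English description precedes it below -/
import Mathlib

section
/- Let R be a commutative ring, m ≥ 1, and let I and J be ideals of R. If A, B ∈ GL_m(R) satisfy A ≡ 1 mod I and B ≡ 1 mod J (meaning every entry of A − 1 lies in I and every entry of B − 1 lies in J), then the commutator satisfies A B A⁻¹ B⁻¹ ≡ 1 mod I·J, i.e. every entry of A B A⁻¹ B⁻¹ − 1 lies in the product ideal I·J. -/
open scoped MatrixGroups

/-- For a commutative ring `R`, `m ≥ 1`, and ideals `I`, `J` of `R`,
if `A, B ∈ GL_m(R)` satisfy `A ≡ 1 mod I` and `B ≡ 1 mod J` (entrywise), then the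
commutator `A * B * A⁻¹ * B⁻¹` is `≡ 1 mod I * J` (entrywise). -/
theorem commutator_congruent_one_mod_mul
    (R : Type*) [CommRing R] (m : ℕ) (hm : 1 ≤ m) (I J : Ideal R)
    (A B : GL (Fin m) R)
    (hA : ∀ i j, ((↑A : Matrix (Fin m) (Fin m) R) - 1) i j ∈ I)
    (hB : ∀ i j, ((↑B : Matrix (Fin m) (Fin m) R) - 1) i j ∈ J) :
    ∀ i j, ((↑(A * B * A⁻¹ * B⁻¹) : Matrix (Fin m) (Fin m) R) - 1) i j ∈ I * J := by
  intro i j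
  have key : ((↑(A * B * A⁻¹ * B⁻¹) : Matrix (Fin m) (Fin m) R) - 1)
      = (((↑A : Matrix (Fin m) (Fin m) R) - 1) * ((↑B : Matrix (Fin m) (Fin m) R) - 1)
        - ((↑B : Matrix (Fin m) (Fin m) R) - 1) * ((↑A : Matrix (Fin m) (Fin m) R) - 1))
        * (↑(A⁻¹ * B⁻¹) : Matrix (Fin m) (Fin m) R) := by
    have h1 : (↑(A * B * A⁻¹ * B⁻¹) : Matrix (Fin m) (Fin m) R)
        = (A.val * B.val) * (↑(A⁻¹ * B⁻¹) : Matrix (Fin m) (Fin m) R) := by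
      rw [mul_assoc (A * B), Units.val_mul, Units.val_mul A B]
    have h2 : (1 : Matrix (Fin m) (Fin m) R)
        = (B.val * A.val) * (↑(A⁻¹ * B⁻¹) : Matrix (Fin m) (Fin m) R) := by
      rw [← Units.val_mul B A, ← Units.val_mul]
      simp [← mul_inv_rev]
    have h3 : ((↑A : Matrix (Fin m) (Fin m) R) - 1) * ((↑B : Matrix (Fin m) (Fin m) R) - 1)
        - ((↑B : Matrix (Fin m) (Fin m) R) - 1) * ((↑A : Matrix (Fin m) (Fin m) R) - 1)
        = A.val * B.val - B.val * A.val := by noncomm_ring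
    rw [h3, sub_mul, ← h1, ← h2]
  rw [key, Matrix.mul_apply]
  refine Ideal.sum_mem _ fun k _ => Ideal.mul_mem_right _ _ ?_
  rw [Matrix.sub_apply, Matrix.mul_apply, Matrix.mul_apply]
  refine Ideal.sub_mem _ (Ideal.sum_mem _ fun l _ => Ideal.mul_mem_mul (hA _ _) (hB _ _))
    (Ideal.sum_mem _ fun l _ => ?_)
  rw [mul_comm I J]
  exact Ideal.mul_mem_mul (hB _ _) (hA _ _)
end

section
/- Let G be a finite group and (ρ, V) a nonzero finite-dimensional complex representation of G. Then the set X(ρ) = {χ ∈ Hom(G, ℂˣ) : the twisted representation χ ⊗ ρ is isomorphic to ρ} is a subgroup of the group Hom(G, ℂˣ), and its cardinality satisfies |X(ρ)| ≤ (dim_ℂ V)². -/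
/-- The twist `χ ⊗ ρ` of a representation `ρ` by a character `χ : G →* ℂˣ`,
acting by `g ↦ χ(g) • ρ(g)`. -/
def twist {G V : Type*} [Group G] [AddCommGroup V] [Module ℂ V]
    (ρ : Representation ℂ G V) (χ : G →* ℂˣ) : Representation ℂ G V where
  toFun g := (χ g : ℂ) • ρ g
  map_one' := by simp
  map_mul' g h := by
    simp only [map_mul, Units.val_mul, smul_mul_assoc, mul_smul_comm, smul_smul, mul_comm]

/-- Two representations of `G` on `V` are isomorphic (equivalent). -/
def RepIso {G V : Type*} [Group G] [AddCommGroup V] [Module ℂ V]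
    (ρ σ : Representation ℂ G V) : Prop :=
  ∃ e : V ≃ₗ[ℂ] V, ∀ (g : G) (v : V), e (ρ g v) = σ g (e v)

lemma twist_eigen {G V : Type*} [Group G] [AddCommGroup V] [Module ℂ V]
    (ρ : Representation ℂ G V) (χ : G →* ℂˣ) (e : V ≃ₗ[ℂ] V)
    (he : ∀ (g : G) (v : V), e (twist ρ χ g v) = ρ g (e v)) (g : G) (v : V) :
    (χ g : ℂ) • e (ρ g v) = ρ g (e v) := by
  rw [← he]
  simp [twist]

lemma twist_indep {G V : Type*} [Group G] [AddCommGroup V] [Module ℂ V]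
    [Nontrivial V] (ρ : Representation ℂ G V)
    (e : {χ : G →* ℂˣ | RepIso (twist ρ χ) ρ} → (V ≃ₗ[ℂ] V))
    (he : ∀ χ (g : G) (v : V), e χ (twist ρ χ.1 g v) = ρ g (e χ v)) :
    LinearIndependent ℂ (fun χ => (e χ : V →ₗ[ℂ] V)) := by
  have hchar : LinearIndependent ℂ (fun χ : {χ : G →* ℂˣ | RepIso (twist ρ χ) ρ} =>
      (fun g => ((χ.1 g : ℂˣ) : ℂ) : G → ℂ)) := by
    have h := linearIndependent_monoidHom G ℂ
    refine h.comp (fun χ : {χ : G →* ℂˣ | RepIso (twist ρ χ) ρ} =>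
      (Units.coeHom ℂ).comp χ.1) ?_
    intro a b hab
    apply Subtype.ext
    ext g
    exact DFunLike.congr_fun hab g
  rw [linearIndependent_iff'] at hchar ⊢
  intro s c hc i hi
  obtain ⟨v, hv⟩ := exists_ne (0 : V)
  have key : ∀ g : G, ∀ w : V, ∑ χ ∈ s, (c χ * ((χ.1 g : ℂˣ) : ℂ)) • e χ w = 0 := by
    intro g w
    have h1 := LinearMap.congr_fun hc (ρ g⁻¹ w)
    simp only [LinearMap.sum_apply, LinearMap.smul_apply, LinearEquiv.coe_coe,
      LinearMap.zero_apply] at h1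
    have h2 := congrArg (ρ g) h1
    rw [map_sum, map_zero] at h2
    rw [← h2]
    refine Finset.sum_congr rfl fun χ _ => ?_
    rw [map_smul, ← twist_eigen ρ χ.1 (e χ) (he χ), mul_smul]
    simp
  have h0 : c i • e i v = 0 := by
    rw [← Module.forall_dual_apply_eq_zero_iff ℂ]
    intro f
    rw [map_smul, smul_eq_mul]
    refine hchar s (fun χ => c χ * f (e χ v)) ?_ i hi
    ext g
    have h3 := congrArg f (key g v)
    rw [map_sum, map_zero] at h3
    simp only [Finset.sum_apply, Pi.smul_apply, smul_eq_mul, Pi.zero_apply]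
    rw [← h3]
    refine Finset.sum_congr rfl fun χ _ => ?_
    rw [map_smul, smul_eq_mul]
    ring
  rcases smul_eq_zero.1 h0 with h | h
  · exact h
  · exact absurd ((e i).map_eq_zero_iff.1 h) hv

/-- For a finite group `G` and a nonzero finite-dimensional complex
representation `(ρ, V)`, the set `X(ρ)` of characters `χ : G → ℂˣ` with `χ ⊗ ρ ≅ ρ` is
a subgroup of `Hom(G, ℂˣ)`, of cardinality at most `(dim V)²`. -/
theorem twist_fixing_characters_subgroup_card_le
    {G V : Type*} [Group G] [Fintype G] [AddCommGroup V] [Module ℂ V]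
    [FiniteDimensional ℂ V] [Nontrivial V] (ρ : Representation ℂ G V) :
    ∃ H : Subgroup (G →* ℂˣ),
      ((H : Set (G →* ℂˣ)) = {χ : G →* ℂˣ | RepIso (twist ρ χ) ρ}) ∧
      Nat.card {χ : G →* ℂˣ | RepIso (twist ρ χ) ρ} ≤ (Module.finrank ℂ V) ^ 2 := by
  refine ⟨{ carrier := {χ : G →* ℂˣ | RepIso (twist ρ χ) ρ}, mul_mem' := ?_,
            one_mem' := ?_, inv_mem' := ?_ }, rfl, ?_⟩
  · rintro a b ⟨e, he⟩ ⟨f, hf⟩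
    refine ⟨e.trans f, fun g v => ?_⟩
    have h1 := twist_eigen ρ a e he g v
    have h2 := twist_eigen ρ b f hf g (e v)
    rw [LinearEquiv.trans_apply, LinearEquiv.trans_apply, ← h2, ← h1]
    change f (e ((((a * b) g : ℂˣ) : ℂ) • ρ g v)) = _
    rw [map_smul, map_smul, map_smul, smul_smul, MonoidHom.mul_apply, Units.val_mul, mul_comm]
  · exact ⟨LinearEquiv.refl ℂ V, fun g v => by simp [twist]⟩
  · rintro a ⟨e, he⟩
    refine ⟨e.symm, fun g v => ?_⟩
    have h1 := twist_eigen ρ a e he g (e.symm v)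
    rw [e.apply_symm_apply] at h1
    simp [twist, ← h1, smul_smul]
  · choose e he using fun χ : {χ : G →* ℂˣ | RepIso (twist ρ χ) ρ} => χ.2
    have hli := twist_indep ρ e he
    haveI := hli.finite
    haveI := Fintype.ofFinite {χ : G →* ℂˣ | RepIso (twist ρ χ) ρ}
    have := hli.fintype_card_le_finrank
    rwa [Module.finrank_linearMap, ← sq, ← Nat.card_eq_fintype_card] at this
end
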